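/- Assume m,n → ∞ with m/n → μ ∈ (0,∞), P^{(n)} → P weakly, and P^{(n)}_{10} → P_{10} ∈ (0,∞). Fix s,t ∈ ℕ and M > 0 with P(X ≤ M) > 0 for (X,Y) ~ P. Let K = {k : X_{n,k} ≤ M} and let Ĝ be the graph on {1,…,n} with edge set ⋃_{k∈K} E(G_{n,k}); write d̂_i = deg_{Ĝ}(i). Then, as n → ∞, P(d̂_1 = s, d̂_2 = t) = P(d̂_1 = s) P(d̂_2 = t) + o(1). -/

import Mathlib

open MeasureTheory ProbabilityTheory Filter
open scoped ENNReal Topology Classical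

noncomputable section

/-- The binomial probability mass function `Bin(x,y)(s)`. -/
def binP (x : ℕ) (y : ℝ) (s : ℕ) : ℝ := (x.choose s : ℝ) * y ^ s * (1 - y) ^ (x - s)

/-- Convolution of (mass) functions on `ℕ`. -/
def conv (f g : ℕ → ℝ) (s : ℕ) : ℝ := ∑ i ∈ Finset.range (s + 1), f i * g (s - i)

/-- Iterated convolution power: `convPow f j` is the `j`-fold convolution of `f`. -/
def convPow (f : ℕ → ℝ) : ℕ → ℕ → ℝ
  | 0 => fun s => if s = 0 then 1 else 0
  | j + 1 => conv f (convPow f j)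

/-- The compound Poisson probability mass function `CPoi(lam, f)`, i.e. the law of
`H_1 + ⋯ + H_Λ` where `Λ ~ Poi(lam)` and the `H_k` are i.i.d. with mass function `f`,
independent of `Λ`. -/
def cpoi (lam : ℝ) (f : ℕ → ℝ) (s : ℕ) : ℝ :=
  ∑' j : ℕ, Real.exp (-lam) * lam ^ j / (j.factorial : ℝ) * convPow f j s

/-- Convolution of (mass) functions on `ℕ × ℕ`. -/
def conv2 (F G : ℕ → ℕ → ℝ) (s t : ℕ) : ℝ :=
  ∑ i ∈ Finset.range (s + 1), ∑ j ∈ Finset.range (t + 1), F i j * G (s - i) (t - j)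

/-- Point mass at `(1,1)`, as a mass function on `ℕ × ℕ`. -/
def delta11 (s t : ℕ) : ℝ := if s = 1 ∧ t = 1 then 1 else 0

/-- The cross moment `Q_{rs} = E[(X)_r Y^s]` of a layer type distribution `Q`,
where `(x)_r` is the falling factorial. -/
def mom (Q : Measure (ℕ × ℝ)) (r s : ℕ) : ℝ :=
  ∫ p, (p.1.descFactorial r : ℝ) * p.2 ^ s ∂Q

/-- The increment distribution `g(s) = ∫ Bin(x-1,y)(s) x P(dx,dy) / P₁₀`. -/
def gInc (P : Measure (ℕ × ℝ)) (s : ℕ) : ℝ :=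
  (∫ p, (p.1 : ℝ) * binP (p.1 - 1) p.2 s ∂P) / mom P 1 0

/-- The limiting degree distribution `\bar f_1 = CPoi(μ P₁₀, g)`. -/
def barf1 (mu : ℝ) (P : Measure (ℕ × ℝ)) (s : ℕ) : ℝ :=
  cpoi (mu * mom P 1 0) (gInc P) s

/-- The distribution `f₂'` of `(D₁', D₂')`:
`f₂'(s,t) = ∫ Bin(x-2,y)(s) Bin(x-2,y)(t) (x)₂ y P(dx,dy) / P₂₁`. -/
def f2p (P : Measure (ℕ × ℝ)) (s t : ℕ) : ℝ :=
  (∫ p, (p.1.descFactorial 2 : ℝ) * p.2 * binP (p.1 - 2) p.2 s * binP (p.1 - 2) p.2 t ∂P) /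
    mom P 2 1

/-- The limiting bidegree distribution `\bar f₂ = δ₍₁,₁₎ ∗ (\bar f₁ ⊗ \bar f₁) ∗ f₂'`. -/
def barf2 (mu : ℝ) (P : Measure (ℕ × ℝ)) : ℕ → ℕ → ℝ :=
  conv2 (conv2 delta11 fun s t => barf1 mu P s * barf1 mu P t) (f2p P)

instance (n : ℕ) : MeasurableSpace (Finset (Fin n)) := ⊤

/-- Bernoulli distribution on `Bool` with success probability `y` (truncated into `[0,1]`). -/
def bern (y : ℝ) : Measure Bool :=
  (PMF.bernoulli (min (Real.toNNReal y) 1) (min_le_right _ _)).toMeasure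

instance (y : ℝ) : IsProbabilityMeasure (bern y) :=
  PMF.toMeasure.isProbabilityMeasure _

/-- The distribution of the indicator of one potential edge `e` of a layer with node set `V`
and strength `y`: Bernoulli(`y`) if `e` is a non-loop pair inside `V`, and surely absent
otherwise. -/
def edgeFactor (n : ℕ) (V : Finset (Fin n)) (y : ℝ) (e : Sym2 (Fin n)) : Measure Bool :=
  if ¬ e.IsDiag ∧ ∀ v ∈ e, v ∈ V then bern y else Measure.dirac false

instance (n : ℕ) (V : Finset (Fin n)) (y : ℝ) (e : Sym2 (Fin n)) :
    IsProbabilityMeasure (edgeFactor n V y e) := by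
  unfold edgeFactor; split <;> infer_instance

/-- Conditionally on the node set `V` and strength `y`, each non-loop pair of nodes of `V`
is linked independently with probability `y`. -/
def edgeMeasure (n : ℕ) (V : Finset (Fin n)) (y : ℝ) : Measure (Sym2 (Fin n) → Bool) :=
  Measure.pi fun e => edgeFactor n V y e

/-- Uniformly random subset of the `n` nodes of size `x`. -/
def vertexMeasure (n x : ℕ) : Measure (Finset (Fin n)) :=
  if h : (Finset.powersetCard x (Finset.univ : Finset (Fin n))).Nonempty then
    (PMF.uniformOfFinset _ h).toMeasure
  else Measure.dirac ∅

/-- A sampled layer: its type `(x,y)`, its node set, and its edge indicators. -/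
abbrev Layer (n : ℕ) := (ℕ × ℝ) × Finset (Fin n) × (Sym2 (Fin n) → Bool)

/-- The distribution of a single layer with type distribution `Q`: the type `(x,y)` is
sampled from `Q`; conditionally on it, the node set is a uniformly random subset of size
`x` of the `n` nodes, and each pair of nodes of the node set is linked independently with
probability `y`. -/
def layerMeasure (n : ℕ) (Q : Measure (ℕ × ℝ)) : Measure (Layer n) :=
  Q.bind fun xy =>
    (vertexMeasure n xy.1).bind fun V =>
      (edgeMeasure n V xy.2).map fun f => (xy, V, f)

instance (n x : ℕ) : IsProbabilityMeasure (vertexMeasure n x) := by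
  unfold vertexMeasure; split <;> infer_instance

instance (n : ℕ) (V : Finset (Fin n)) (y : ℝ) : IsProbabilityMeasure (edgeMeasure n V y) := by
  unfold edgeMeasure; infer_instance

theorem measure_bind_univ_le {α β : Type*} [MeasurableSpace α] [MeasurableSpace β]
    (Q : Measure α) [IsProbabilityMeasure Q] {f : α → Measure β}
    (hf : ∀ a, f a Set.univ ≤ 1) : Q.bind f Set.univ ≤ 1 := by
  rw [Measure.bind, Measure.join_apply MeasurableSet.univ]
  by_cases hmeas : AEMeasurable f Q
  · rw [lintegral_map' (Measure.measurable_coe MeasurableSet.univ).aemeasurable hmeas]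
    calc ∫⁻ a, f a Set.univ ∂Q ≤ ∫⁻ _, 1 ∂Q := lintegral_mono hf
      _ = 1 := by simp
  · rw [Measure.map_of_not_aemeasurable hmeas]; simp

instance (n : ℕ) (Q : Measure (ℕ × ℝ)) [IsProbabilityMeasure Q] :
    IsFiniteMeasure (layerMeasure n Q) := by
  refine ⟨lt_of_le_of_lt ?_ ENNReal.one_lt_top⟩
  refine measure_bind_univ_le Q fun xy => ?_
  refine measure_bind_univ_le _ fun V => ?_
  have hg : Measurable fun f : Sym2 (Fin n) → Bool => ((xy, V, f) : Layer n) :=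
    measurable_const.prodMk (measurable_const.prodMk measurable_id)
  rw [Measure.map_apply hg MeasurableSet.univ]
  simp

/-- The Bernoulli random graph superposition model `G_n` with `n` nodes and `m` mutually
independent layers, each with type distribution `Q`. -/
def modelMeasure (n m : ℕ) (Q : Measure (ℕ × ℝ)) [IsProbabilityMeasure Q] :
    Measure (Fin m → Layer n) :=
  Measure.pi fun _ => layerMeasure n Q

/-- The edge set `E(G_{n,k})` of one layer. -/
def layerEdges {n : ℕ} (L : Layer n) : Finset (Sym2 (Fin n)) :=
  Finset.univ.filter fun e => L.2.2 e = true ∧ ¬ e.IsDiag ∧ ∀ v ∈ e, v ∈ L.2.1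

/-- The edge set `E(G_n) = ⋃ₖ E(G_{n,k})` of the superposition graph. -/
def graphEdges {n m : ℕ} (ω : Fin m → Layer n) : Finset (Sym2 (Fin n)) :=
  Finset.univ.biUnion fun k => layerEdges (ω k)

/-- The degree `deg_{G_n}(i)` of the node with label `i` (labels start from `0`). -/
def deg {n m : ℕ} (ω : Fin m → Layer n) (i : ℕ) : ℕ :=
  ((graphEdges ω).filter fun e => ∃ v : Fin n, v ∈ e ∧ (v : ℕ) = i).card

/-- The event that the first two nodes (labels `0` and `1`) are adjacent in `G_n`. -/
def adjEvent (n m : ℕ) : Set (Fin m → Layer n) :=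
  {ω | ∃ e ∈ graphEdges ω, (∃ v : Fin n, v ∈ e ∧ (v : ℕ) = 0) ∧ ∃ v : Fin n, v ∈ e ∧ (v : ℕ) = 1}

/-- The model bidegree distribution
`f_{2,n}(s,t) = P(deg(1) = s, deg(2) = t ∣ {1,2} ∈ E(G_n))`. -/
def bidegree (n m : ℕ) (Q : Measure (ℕ × ℝ)) [IsProbabilityMeasure Q] (s t : ℕ) : ℝ :=
  ((modelMeasure n m Q)[|adjEvent n m] {ω | deg ω 0 = s ∧ deg ω 1 = t}).toReal

/-- The edge set of a layer, kept only if the layer size is at most `M`. -/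
def layerEdgesTr {n : ℕ} (M : ℝ) (L : Layer n) : Finset (Sym2 (Fin n)) :=
  if (L.1.1 : ℝ) ≤ M then layerEdges L else ∅

/-- The edge set `E(Ĝ) = ⋃_{k : X_{n,k} ≤ M} E(G_{n,k})` of the truncated graph. -/
def graphEdgesTr {n m : ℕ} (M : ℝ) (ω : Fin m → Layer n) : Finset (Sym2 (Fin n)) :=
  Finset.univ.biUnion fun k => layerEdgesTr M (ω k)

/-- The degree `d̂_i = deg_{Ĝ}(i)` in the truncated graph. -/
def degTr {n m : ℕ} (M : ℝ) (ω : Fin m → Layer n) (i : ℕ) : ℕ :=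
  ((graphEdgesTr M ω).filter fun e => ∃ v : Fin n, v ∈ e ∧ (v : ℕ) = i).card

theorem integrable_of_mem_Icc_zero_one {Ω : Type*} [MeasurableSpace Ω] (κ : Measure Ω)
    [IsProbabilityMeasure κ] {w : Ω → ℝ} (hw : Measurable w)
    (h : ∀ x, w x ∈ Set.Icc (0 : ℝ) 1) : Integrable w κ :=
  Integrable.of_mem_Icc 0 1 hw.aemeasurable (ae_of_all _ h)

theorem integral_mem_Icc_zero_one {Ω : Type*} [MeasurableSpace Ω] (κ : Measure Ω)
    [IsProbabilityMeasure κ] {w : Ω → ℝ} (hw : Measurable w)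
    (h : ∀ x, w x ∈ Set.Icc (0 : ℝ) 1) : ∫ x, w x ∂κ ∈ Set.Icc (0 : ℝ) 1 := by
  refine ⟨integral_nonneg fun x => (h x).1, ?_⟩
  simpa using integral_mono (integrable_of_mem_Icc_zero_one κ hw h) (integrable_const 1)
    fun x => (h x).2

theorem abs_integral_mul_sub_mul_le {S : Type*} [MeasurableSpace S] (ν : Measure S)
    [IsProbabilityMeasure ν] {u v : S → ℝ} (hu : Measurable u) (hv : Measurable v)
    (hu01 : ∀ x, u x ∈ Set.Icc (0 : ℝ) 1) (hv01 : ∀ x, v x ∈ Set.Icc (0 : ℝ) 1)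
    {c d : ℝ} (hc : c ∈ Set.Icc (0 : ℝ) 1) (hd : d ∈ Set.Icc (0 : ℝ) 1)
    {E F : Set S} (hE : MeasurableSet E) (hF : MeasurableSet F)
    (huE : ∀ x ∉ E, u x = c) (hvF : ∀ x ∉ F, v x = d) :
    |∫ x, u x * v x ∂ν - (∫ x, u x ∂ν) * ∫ x, v x ∂ν| ≤
      ν.real (E ∩ F) + ν.real E * ν.real F := by
  have key : ∀ {w : S → ℝ} {G : Set S}, MeasurableSet G → (∀ x ∈ G, |w x| ≤ 1) →
      (∀ x ∉ G, w x = 0) → |∫ x, w x ∂ν| ≤ ν.real G := by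
    intro w G hG h1 h0
    rw [← integral_indicator_one hG, ← Real.norm_eq_abs]
    refine norm_integral_le_of_norm_le ((integrable_const 1).indicator hG) (ae_of_all _ fun x => ?_)
    by_cases hx : x ∈ G
    · simpa [hx] using h1 x hx
    · simp [hx, h0 x hx]
  have bound : ∀ {a b : ℝ}, a ∈ Set.Icc (0 : ℝ) 1 → b ∈ Set.Icc (0 : ℝ) 1 → |a - b| ≤ 1 := by
    rintro a b ⟨h1, h2⟩ ⟨h3, h4⟩
    exact abs_le.2 ⟨by linarith, by linarith⟩
  have iu : Integrable u ν := integrable_of_mem_Icc_zero_one ν hu hu01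
  have iv : Integrable v ν := integrable_of_mem_Icc_zero_one ν hv hv01
  have iuv : Integrable (fun x => u x * v x) ν :=
    integrable_of_mem_Icc_zero_one ν (hu.mul hv) fun x => unitInterval.mul_mem (hu01 x) (hv01 x)
  have b1 : |∫ x, (u x - c) * (v x - d) ∂ν| ≤ ν.real (E ∩ F) := by
    refine key (hE.inter hF) (fun x _ => ?_) fun x hx => ?_
    · rw [abs_mul]
      exact mul_le_one₀ (bound (hu01 x) hc) (abs_nonneg _) (bound (hv01 x) hd)
    · by_cases hxE : x ∈ E
      · simp [hvF x fun h => hx ⟨hxE, h⟩]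
      · simp [huE x hxE]
  have b2 : |∫ x, (u x - c) ∂ν| ≤ ν.real E :=
    key hE (fun x _ => bound (hu01 x) hc) fun x hx => by simp [huE x hx]
  have b3 : |∫ x, (v x - d) ∂ν| ≤ ν.real F :=
    key hF (fun x _ => bound (hv01 x) hd) fun x hx => by simp [hvF x hx]
  have e1 : ∫ x, (u x - c) * (v x - d) ∂ν =
      ∫ x, u x * v x ∂ν - d * ∫ x, u x ∂ν - c * ∫ x, v x ∂ν + c * d := by
    have : ∀ x, (u x - c) * (v x - d) = u x * v x - d * u x - c * v x + c * d := fun x => by ring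
    simp_rw [this]
    have i1 : Integrable (fun x => u x * v x - d * u x) ν := iuv.sub (iu.const_mul d)
    have i2 : Integrable (fun x => u x * v x - d * u x - c * v x) ν := i1.sub (iv.const_mul c)
    rw [integral_add i2 (integrable_const _), integral_sub i1 (iv.const_mul c),
      integral_sub iuv (iu.const_mul d), integral_const_mul, integral_const_mul]
    simp
  have e2 : ∫ x, (u x - c) ∂ν = ∫ x, u x ∂ν - c := by
    rw [integral_sub iu (integrable_const _)]; simp
  have e3 : ∫ x, (v x - d) ∂ν = ∫ x, v x ∂ν - d := by
    rw [integral_sub iv (integrable_const _)]; simp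
  have e4 : ∫ x, u x * v x ∂ν - (∫ x, u x ∂ν) * ∫ x, v x ∂ν =
      ∫ x, (u x - c) * (v x - d) ∂ν - (∫ x, (u x - c) ∂ν) * ∫ x, (v x - d) ∂ν := by
    rw [e1, e2, e3]; ring
  rw [e4]
  refine (abs_sub _ _).trans (add_le_add b1 ?_)
  rw [abs_mul]
  exact mul_le_mul b2 b3 (abs_nonneg _) measureReal_nonneg

theorem integral_pi_fin_succ {S : Type*} [MeasurableSpace S] (ν : Measure S)
    [IsProbabilityMeasure ν] {m : ℕ} {h : (Fin (m + 1) → S) → ℝ}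
    (hi : Integrable h (Measure.pi fun _ => ν)) :
    ∫ ω, h ω ∂(Measure.pi fun _ => ν) =
      ∫ x, ∫ ω, h (Fin.cons x ω) ∂(Measure.pi fun _ : Fin m => ν) ∂ν := by
  have mp := (measurePreserving_piFinSuccAbove (fun _ : Fin (m + 1) => ν) 0).symm
  rw [← mp.integral_comp', integral_prod]
  · simp [MeasurableEquiv.piFinSuccAbove, Fin.insertNthEquiv]
  · exact (mp.integrable_comp_emb (MeasurableEquiv.measurableEmbedding _)).2 hi

theorem abs_integral_pi_mul_sub_mul_le {S α β : Type*} [MeasurableSpace S]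
    [MeasurableSpace α] [MeasurableSpace β] [Finite α] [Finite β]
    [MeasurableSingletonClass α] [MeasurableSingletonClass β] (ν : Measure S)
    [IsProbabilityMeasure ν] {A : S → α} {B : S → β} (hA : Measurable A) (hB : Measurable B)
    (a₀ : α) (b₀ : β) (m : ℕ) (f : (Fin m → α) → ℝ) (g : (Fin m → β) → ℝ)
    (hf : ∀ a, f a ∈ Set.Icc (0 : ℝ) 1) (hg : ∀ b, g b ∈ Set.Icc (0 : ℝ) 1) :
    |∫ ω, f (A ∘ ω) * g (B ∘ ω) ∂(Measure.pi fun _ => ν) -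
        (∫ ω, f (A ∘ ω) ∂(Measure.pi fun _ => ν)) * ∫ ω, g (B ∘ ω) ∂(Measure.pi fun _ => ν)| ≤
      m * (ν.real ({x | A x ≠ a₀} ∩ {x | B x ≠ b₀}) +
        ν.real {x | A x ≠ a₀} * ν.real {x | B x ≠ b₀}) := by
  have mA : ∀ (k : ℕ) (φ : (Fin k → α) → ℝ), Measurable fun ω : Fin k → S => φ (A ∘ ω) :=
    fun k φ => (measurable_of_countable φ).comp
      (measurable_pi_lambda _ fun i => hA.comp (measurable_pi_apply i))
  have mB : ∀ (k : ℕ) (φ : (Fin k → β) → ℝ), Measurable fun ω : Fin k → S => φ (B ∘ ω) :=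
    fun k φ => (measurable_of_countable φ).comp
      (measurable_pi_lambda _ fun i => hB.comp (measurable_pi_apply i))
  induction m with
  | zero =>
    have hA0 : ∀ ω : Fin 0 → S, A ∘ ω = Fin.elim0 := fun _ => Subsingleton.elim _ _
    have hB0 : ∀ ω : Fin 0 → S, B ∘ ω = Fin.elim0 := fun _ => Subsingleton.elim _ _
    simp [hA0, hB0]
  | succ m ih =>
    have hcA : ∀ (x : S) (ω : Fin m → S),
        A ∘ (Fin.cons x ω : Fin (m + 1) → S) = Fin.cons (A x) (A ∘ ω) :=
      fun x ω => by funext i; refine Fin.cases ?_ (fun _ => ?_) i <;> simp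
    have hcB : ∀ (x : S) (ω : Fin m → S),
        B ∘ (Fin.cons x ω : Fin (m + 1) → S) = Fin.cons (B x) (B ∘ ω) :=
      fun x ω => by funext i; refine Fin.cases ?_ (fun _ => ?_) i <;> simp
    set ε := ν.real ({x | A x ≠ a₀} ∩ {x | B x ≠ b₀}) +
        ν.real {x | A x ≠ a₀} * ν.real {x | B x ≠ b₀}
    set π : Measure (Fin m → S) := Measure.pi fun _ => ν
    have mfg : Measurable fun ω : Fin (m + 1) → S => f (A ∘ ω) * g (B ∘ ω) :=
      (mA _ f).mul (mB _ g)
    rw [integral_pi_fin_succ ν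
        (integrable_of_mem_Icc_zero_one _ mfg fun x => unitInterval.mul_mem (hf _) (hg _)),
      integral_pi_fin_succ ν (integrable_of_mem_Icc_zero_one _ (mA _ f) fun x => hf _),
      integral_pi_fin_succ ν (integrable_of_mem_Icc_zero_one _ (mB _ g) fun x => hg _)]
    simp_rw [hcA, hcB]
    let φ : α → ℝ := fun a => ∫ ω, f (Fin.cons a (A ∘ ω)) ∂π
    let γ : β → ℝ := fun b => ∫ ω, g (Fin.cons b (B ∘ ω)) ∂π
    let ψ : α × β → ℝ := fun p => ∫ ω, f (Fin.cons p.1 (A ∘ ω)) * g (Fin.cons p.2 (B ∘ ω)) ∂π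
    have hφ : ∀ a, φ a ∈ Set.Icc (0 : ℝ) 1 := fun a =>
      integral_mem_Icc_zero_one π (mA m fun c => f (Fin.cons a c)) fun _ => hf _
    have hγ : ∀ b, γ b ∈ Set.Icc (0 : ℝ) 1 := fun b =>
      integral_mem_Icc_zero_one π (mB m fun c => g (Fin.cons b c)) fun _ => hg _
    have hψ : ∀ p, ψ p ∈ Set.Icc (0 : ℝ) 1 := fun p =>
      integral_mem_Icc_zero_one π ((mA m fun c => f (Fin.cons p.1 c)).mul (mB m fun c => g (Fin.cons p.2 c)))
        fun _ => unitInterval.mul_mem (hf _) (hg _)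
    have mφ : Measurable fun x => φ (A x) := (measurable_of_countable φ).comp hA
    have mγ : Measurable fun x => γ (B x) := (measurable_of_countable γ).comp hB
    have mψ : Measurable fun x => ψ (A x, B x) :=
      (measurable_of_countable ψ).comp (hA.prodMk hB)
    have mφγ : Measurable fun x => φ (A x) * γ (B x) := mφ.mul mγ
    have step : |∫ x, ψ (A x, B x) ∂ν - ∫ x, φ (A x) * γ (B x) ∂ν| ≤ m * ε := by
      rw [← integral_sub (integrable_of_mem_Icc_zero_one ν mψ fun x => hψ _)
        (integrable_of_mem_Icc_zero_one ν mφγ fun x => unitInterval.mul_mem (hφ _) (hγ _)), ← Real.norm_eq_abs]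
      refine (norm_integral_le_of_norm_le (integrable_const (m * ε)) (ae_of_all _ fun x => ?_)).trans
        (by simp)
      exact ih (fun c => f (Fin.cons (A x) c)) (fun c => g (Fin.cons (B x) c))
        (fun _ => hf _) fun _ => hg _
    have cov : |∫ x, φ (A x) * γ (B x) ∂ν - (∫ x, φ (A x) ∂ν) * ∫ x, γ (B x) ∂ν| ≤ ε :=
      abs_integral_mul_sub_mul_le ν mφ mγ (fun _ => hφ _) (fun _ => hγ _) (hφ a₀) (hγ b₀)
        (hA (measurableSet_singleton a₀).compl) (hB (measurableSet_singleton b₀).compl)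
        (fun x hx => by rw [not_not.1 hx]) fun x hx => by rw [not_not.1 hx]
    calc _ ≤ _ := abs_sub_le _ (∫ x, φ (A x) * γ (B x) ∂ν) _
      _ ≤ m * ε + ε := add_le_add step cov
      _ = _ := by push_cast; ring

set_option linter.deprecated false in
theorem measurable_bern : Measurable bern := by
  refine Measure.measurable_of_measurable_coe _ fun s _ => ?_
  simp only [bern, PMF.toMeasure_apply_fintype, Fintype.univ_bool, Set.indicator_apply]
  refine Finset.measurable_sum _ fun b _ => ?_
  split_ifs
  · cases b <;> simp only [PMF.bernoulli_apply, cond_true, cond_false] <;> fun_prop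
  · exact measurable_const

theorem measurable_edgeMeasure (n : ℕ) (V : Finset (Fin n)) : Measurable (edgeMeasure n V) := by
  refine Measurable.measure_of_isPiSystem_of_isProbabilityMeasure generateFrom_pi.symm isPiSystem_pi
    ?_
  rintro _ ⟨s, hs, rfl⟩
  simp only [edgeMeasure, Measure.pi_pi]
  refine Finset.measurable_prod _ fun e _ => ?_
  unfold edgeFactor
  split_ifs
  · exact (Measure.measurable_coe (show MeasurableSet (s e) from hs e (Set.mem_univ e))).comp measurable_bern
  · exact measurable_const

theorem measurable_layer_mk {n : ℕ} (xy : ℕ × ℝ) (V : Finset (Fin n)) :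
    Measurable fun f : Sym2 (Fin n) → Bool => ((xy, V, f) : Layer n) :=
  measurable_const.prodMk (measurable_const.prodMk measurable_id)

/-- The conditional distribution of a layer of type `xy`. -/
def typedLayerMeasure (n : ℕ) (xy : ℕ × ℝ) : Measure (Layer n) :=
  (vertexMeasure n xy.1).bind fun V => (edgeMeasure n V xy.2).map fun f => (xy, V, f)

theorem typedLayerMeasure_apply (n : ℕ) (xy : ℕ × ℝ) {S : Set (Layer n)} (hS : MeasurableSet S) :
    typedLayerMeasure n xy S =
      ∑ V, edgeMeasure n V xy.2 {f | (xy, V, f) ∈ S} * vertexMeasure n xy.1 {V} := by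
  rw [typedLayerMeasure, Measure.bind_apply hS (measurable_of_countable _).aemeasurable,
    lintegral_fintype]
  simp_rw [Measure.map_apply (measurable_layer_mk _ _) hS]
  rfl

instance (n : ℕ) (xy : ℕ × ℝ) : IsProbabilityMeasure (typedLayerMeasure n xy) :=
  ⟨by
    rw [typedLayerMeasure_apply n xy MeasurableSet.univ]
    simp⟩

theorem measurable_typedLayerMeasure (n : ℕ) : Measurable (typedLayerMeasure n) := by
  refine Measure.measurable_of_measurable_coe _ fun S hS => ?_
  refine measurable_from_prod_countable_right fun x => ?_
  simp_rw [typedLayerMeasure_apply n _ hS]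
  refine Finset.measurable_sum _ fun V _ => Measurable.mul_const ?_ _
  let κ : Kernel ℝ (Sym2 (Fin n) → Bool) := ⟨edgeMeasure n V, measurable_edgeMeasure n V⟩
  have : IsMarkovKernel κ := ⟨fun y => inferInstanceAs (IsProbabilityMeasure (edgeMeasure n V y))⟩
  have hm : Measurable fun p : ℝ × (Sym2 (Fin n) → Bool) => (((x, p.1), V, p.2) : Layer n) := by
    fun_prop
  exact Kernel.measurable_kernel_prodMk_left (κ := κ) (hm hS)

theorem layerMeasure_apply (n : ℕ) (Q : Measure (ℕ × ℝ)) {S : Set (Layer n)}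
    (hS : MeasurableSet S) : layerMeasure n Q S = ∫⁻ xy, typedLayerMeasure n xy S ∂Q :=
  Measure.bind_apply hS (measurable_typedLayerMeasure n).aemeasurable

instance (n : ℕ) (Q : Measure (ℕ × ℝ)) [IsProbabilityMeasure Q] :
    IsProbabilityMeasure (layerMeasure n Q) :=
  ⟨by simp [layerMeasure_apply n Q MeasurableSet.univ]⟩

theorem vertexMeasure_superset_le (n x : ℕ) {T : Finset (Fin n)} (hT : T.Nonempty) :
    vertexMeasure n x {V | T ⊆ V} ≤ (x.choose T.card : ℝ≥0∞) / (n.choose T.card : ℝ≥0∞) := by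
  unfold vertexMeasure
  split_ifs with h
  · rw [PMF.toMeasure_uniformOfFinset_apply _ _ MeasurableSpace.measurableSet_top]
    have hxn : x ≤ n := by simpa using h
    have hTn : T.card ≤ n := by simpa using T.card_le_univ
    have hcard : (Finset.filter (fun V => V ∈ {V : Finset (Fin n) | T ⊆ V})
        (Finset.powersetCard x Finset.univ)).card * n.choose T.card ≤
        n.choose x * x.choose T.card := by
      rcases le_or_gt T.card x with hTx | hTx
      · rw [Nat.choose_mul hTx, mul_comm]
        gcongr
        simpa using (Finset.card_filter_powersetCard_subset T Finset.univ x T.subset_univ hTx).le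
      · rw [Finset.card_eq_zero.2, zero_mul]
        · exact Nat.zero_le _
        refine Finset.filter_eq_empty_iff.2 fun V hV hTV => ?_
        have := Finset.card_le_card hTV
        rw [(Finset.mem_powersetCard.1 hV).2] at this
        omega
    rw [Finset.card_powersetCard, Finset.card_univ, Fintype.card_fin]
    have p1 : n.choose x ≠ 0 := (Nat.choose_pos hxn).ne'
    have p2 : n.choose T.card ≠ 0 := (Nat.choose_pos hTn).ne'
    rw [ENNReal.div_le_iff (by simpa using p1) (by simp), ENNReal.div_eq_inv_mul, mul_assoc,
      ← ENNReal.div_eq_inv_mul, ENNReal.le_div_iff_mul_le (by simp [p2]) (by simp)]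
    rw [mul_comm (x.choose _ : ℝ≥0∞)]
    convert Nat.cast_le (α := ℝ≥0∞).2 hcard using 1 <;> push_cast <;> congr
  · rw [Measure.dirac_apply' _ MeasurableSpace.measurableSet_top]
    simp [hT.ne_empty]

theorem layerMeasure_superset_le (n : ℕ) (Q : Measure (ℕ × ℝ)) [IsProbabilityMeasure Q] (M : ℝ)
    {T : Finset (Fin n)} (hT : T.Nonempty) :
    (layerMeasure n Q).real {L | (L.1.1 : ℝ) ≤ M ∧ T ⊆ L.2.1} ≤
      (⌊M⌋₊.choose T.card : ℝ) / (n.choose T.card : ℝ) := by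
  have hp : n.choose T.card ≠ 0 := (Nat.choose_pos (by simpa using T.card_le_univ)).ne'
  have hS : MeasurableSet {L : Layer n | (L.1.1 : ℝ) ≤ M ∧ T ⊆ L.2.1} := by
    have h1 : Measurable fun L : Layer n => L.1.1 := by fun_prop
    have h2 : Measurable fun L : Layer n => L.2.1 := by fun_prop
    exact (h1 (MeasurableSet.of_discrete (s := {x : ℕ | (x : ℝ) ≤ M}))).inter
      (h2 (MeasurableSpace.measurableSet_top (s := {V | T ⊆ V})))
  have key : ∀ xy, typedLayerMeasure n xy {L | (L.1.1 : ℝ) ≤ M ∧ T ⊆ L.2.1} ≤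
      (⌊M⌋₊.choose T.card : ℝ≥0∞) / (n.choose T.card : ℝ≥0∞) := by
    intro xy
    rw [typedLayerMeasure, Measure.bind_apply hS (measurable_of_countable _).aemeasurable]
    simp_rw [Measure.map_apply (measurable_layer_mk _ _) hS]
    by_cases hx : (xy.1 : ℝ) ≤ M
    · calc _ = vertexMeasure n xy.1 {V | T ⊆ V} := by
            rw [← lintegral_indicator_one MeasurableSpace.measurableSet_top]
            refine lintegral_congr fun V => ?_
            by_cases hV : T ⊆ V <;> simp [hx, hV]
        _ ≤ _ := vertexMeasure_superset_le n xy.1 hT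
        _ ≤ _ := by
            gcongr
            exact Nat.le_floor hx
    · simp [hx]
  refine ENNReal.toReal_le_of_le_ofReal (by positivity) ?_
  rw [layerMeasure_apply n Q hS, ENNReal.ofReal_div_of_pos (by positivity), ENNReal.ofReal_natCast,
    ENNReal.ofReal_natCast]
  calc _ ≤ ∫⁻ _, (⌊M⌋₊.choose T.card : ℝ≥0∞) / (n.choose T.card : ℝ≥0∞) ∂Q := lintegral_mono key
    _ = _ := by simp

/-- The edges of a truncated layer that are incident to the node with label `i`. -/
def incidentEdgesTr {n : ℕ} (M : ℝ) (i : ℕ) (L : Layer n) : Set (Sym2 (Fin n)) :=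
  {e | e ∈ layerEdgesTr M L ∧ ∃ v : Fin n, v ∈ e ∧ (v : ℕ) = i}

theorem mem_layerEdgesTr {n : ℕ} {M : ℝ} {L : Layer n} {e : Sym2 (Fin n)} :
    e ∈ layerEdgesTr M L ↔
      (L.1.1 : ℝ) ≤ M ∧ L.2.2 e = true ∧ ¬ e.IsDiag ∧ ∀ v ∈ e, v ∈ L.2.1 := by
  unfold layerEdgesTr layerEdges
  split_ifs with h <;> simp [h]

theorem measurable_incidentEdgesTr (n : ℕ) (M : ℝ) (i : ℕ) :
    Measurable (incidentEdgesTr (n := n) M i) := by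
  refine measurable_set_iff.2 fun e => measurableSet_setOfPred.1 ?_
  simp only [incidentEdgesTr, Set.mem_ofPred_eq, mem_layerEdgesTr]
  have h1 : Measurable fun L : Layer n => L.1.1 := by fun_prop
  have h2 : Measurable fun L : Layer n => L.2.1 := by fun_prop
  have h3 : Measurable fun L : Layer n => L.2.2 e := by fun_prop
  exact ((h1 (MeasurableSet.of_discrete (s := {x : ℕ | (x : ℝ) ≤ M}))).inter
    ((h3 (measurableSet_singleton true)).inter ((MeasurableSet.const _).inter
      (h2 (MeasurableSpace.measurableSet_top (s := {V | ∀ v ∈ e, v ∈ V})))))).inter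
        (MeasurableSet.const _)

theorem mem_of_incidentEdgesTr_ne_empty {n : ℕ} {M : ℝ} {i : Fin n} {L : Layer n}
    (h : incidentEdgesTr M i L ≠ ∅) : (L.1.1 : ℝ) ≤ M ∧ i ∈ L.2.1 := by
  obtain ⟨e, he, v, hve, hvi⟩ := Set.nonempty_iff_ne_empty.2 h
  obtain ⟨hM, -, -, hV⟩ := mem_layerEdgesTr.1 he
  obtain rfl := Fin.ext hvi
  exact ⟨hM, hV _ hve⟩

theorem degTr_eq_ncard {n m : ℕ} (M : ℝ) (ω : Fin m → Layer n) (i : ℕ) :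
    degTr M ω i = (⋃ k, incidentEdgesTr M i (ω k)).ncard := by
  rw [degTr, ← Set.ncard_coe_finset]
  congr 1
  ext e
  simp [graphEdgesTr, incidentEdgesTr]

theorem abs_degTr_covariance_le {n : ℕ} (hn : 2 ≤ n) (m : ℕ) (Q : Measure (ℕ × ℝ))
    [IsProbabilityMeasure Q] (M : ℝ) (s t : ℕ) :
    |(modelMeasure n m Q).real {ω | degTr M ω 0 = s ∧ degTr M ω 1 = t} -
        (modelMeasure n m Q).real {ω | degTr M ω 0 = s} *
          (modelMeasure n m Q).real {ω | degTr M ω 1 = t}| ≤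
      m * ((⌊M⌋₊.choose 2 : ℝ) / (n.choose 2 : ℝ) + (⌊M⌋₊ : ℝ) / n * ((⌊M⌋₊ : ℝ) / n)) := by
  let f : ℕ → (Fin m → Set (Sym2 (Fin n))) → ℝ := fun d a => if (⋃ k, a k).ncard = d then 1 else 0
  have f01 : ∀ d a, f d a ∈ Set.Icc (0 : ℝ) 1 := fun d a => by
    by_cases h : (⋃ k, a k).ncard = d <;> simp [f, h]
  have hmeas : ∀ i d, MeasurableSet {ω : Fin m → Layer n | degTr M ω i = d} := fun i d => by
    simp_rw [degTr_eq_ncard]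
    have h : Measurable fun ω : Fin m → Layer n => fun k => incidentEdgesTr M i (ω k) :=
      measurable_pi_lambda _ fun k =>
        (measurable_incidentEdgesTr n M i).comp (measurable_pi_apply k)
    exact h (MeasurableSet.of_discrete (s := {a | (⋃ k, a k).ncard = d}))
  have hprob : ∀ i d, (modelMeasure n m Q).real {ω | degTr M ω i = d} =
      ∫ ω, f d (incidentEdgesTr M i ∘ ω) ∂(Measure.pi fun _ => layerMeasure n Q) := fun i d => by
    rw [← integral_indicator_one (hmeas i d), modelMeasure]
    refine integral_congr_ae (ae_of_all _ fun ω => ?_)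
    simp [f, Set.indicator_apply, degTr_eq_ncard]
  have hjoint : (modelMeasure n m Q).real {ω | degTr M ω 0 = s ∧ degTr M ω 1 = t} =
      ∫ ω, f s (incidentEdgesTr M 0 ∘ ω) * f t (incidentEdgesTr M 1 ∘ ω)
        ∂(Measure.pi fun _ => layerMeasure n Q) := by
    have h : MeasurableSet {ω : Fin m → Layer n | degTr M ω 0 = s ∧ degTr M ω 1 = t} :=
      (hmeas 0 s).inter (hmeas 1 t)
    rw [← integral_indicator_one h, modelMeasure]
    refine integral_congr_ae (ae_of_all _ fun ω => ?_)
    by_cases hs : degTr M ω 0 = s <;> by_cases ht : degTr M ω 1 = t <;>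
      simp_all [f, Set.indicator_apply, degTr_eq_ncard]
  rw [hprob, hprob, hjoint]
  refine (abs_integral_pi_mul_sub_mul_le (layerMeasure n Q) (measurable_incidentEdgesTr n M 0)
    (measurable_incidentEdgesTr n M 1) ∅ ∅ m (f s) (f t) (f01 s) (f01 t)).trans ?_
  have single : ∀ i : Fin n, (layerMeasure n Q).real {L | incidentEdgesTr M i L ≠ ∅} ≤
      (⌊M⌋₊ : ℝ) / n := fun i => by
    refine (measureReal_mono fun L hL => ?_).trans
      ((layerMeasure_superset_le n Q M (Finset.singleton_nonempty i)).trans (by simp))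
    simpa using mem_of_incidentEdgesTr_ne_empty hL
  have h0 := single ⟨0, by omega⟩
  have h1 := single ⟨1, by omega⟩
  gcongr
  have hcard : ({⟨0, by omega⟩, ⟨1, by omega⟩} : Finset (Fin n)).card = 2 :=
    Finset.card_pair (by simp)
  have hpair := layerMeasure_superset_le n Q M (Finset.card_pos.1 (hcard ▸ two_pos))
  rw [hcard] at hpair
  refine (measureReal_mono fun L hL => ?_).trans hpair
  have h0 := mem_of_incidentEdgesTr_ne_empty (i := ⟨0, by omega⟩) hL.1
  have h1 := mem_of_incidentEdgesTr_ne_empty (i := ⟨1, by omega⟩) hL.2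
  refine ⟨h0.1, ?_⟩
  simpa [Finset.insert_subset_iff] using ⟨h0.2, h1.2⟩

/-- **Lemma 2** (Bloznelis–Karjalainen–Leskelä): independence with truncated communities.
Under the assumptions of the compound Poisson limit theorem, for fixed `s`, `t` and
`M > 0` with `P(X ≤ M) > 0`, the degrees of the first two nodes in the graph `Ĝ`
obtained by keeping only the layers of size at most `M` satisfy
`P(d̂₁ = s, d̂₂ = t) = P(d̂₁ = s) P(d̂₂ = t) + o(1)` as `n → ∞`. -/
theorem truncated_degrees_asymptotically_independent
    (mu : ℝ) (hmu : 0 < mu)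
    (m : ℕ → ℕ) (hm : Tendsto m atTop atTop)
    (hratio : Tendsto (fun n : ℕ => (m n : ℝ) / n) atTop (𝓝 mu))
    (Pn : ℕ → ProbabilityMeasure (ℕ × ℝ)) (P : ProbabilityMeasure (ℕ × ℝ))
    (hsupp : ∀ n, (Pn n : Measure (ℕ × ℝ)) {p : ℕ × ℝ | p.1 ≤ n ∧ p.2 ∈ Set.Icc (0:ℝ) 1} = 1)
    (hPsupp : (P : Measure (ℕ × ℝ)) {p : ℕ × ℝ | p.2 ∈ Set.Icc (0:ℝ) 1} = 1)
    (hweak : Tendsto Pn atTop (𝓝 P))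
    (hint10 : Integrable (fun p : ℕ × ℝ => (p.1.descFactorial 1 : ℝ) * p.2 ^ (0:ℕ))
      (P : Measure (ℕ × ℝ)))
    (h10pos : 0 < mom (P : Measure (ℕ × ℝ)) 1 0)
    (h10 : Tendsto (fun n : ℕ => mom (Pn n : Measure (ℕ × ℝ)) 1 0) atTop
      (𝓝 (mom (P : Measure (ℕ × ℝ)) 1 0)))
    (s t : ℕ) (M : ℝ) (hM : 0 < M)
    (hPM : 0 < (P : Measure (ℕ × ℝ)) {p : ℕ × ℝ | (p.1 : ℝ) ≤ M}) :
    Tendsto (fun n : ℕ =>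
        ((modelMeasure n (m n) (Pn n : Measure (ℕ × ℝ)))
            {ω | degTr M ω 0 = s ∧ degTr M ω 1 = t}).toReal -
        ((modelMeasure n (m n) (Pn n : Measure (ℕ × ℝ))) {ω | degTr M ω 0 = s}).toReal *
        ((modelMeasure n (m n) (Pn n : Measure (ℕ × ℝ))) {ω | degTr M ω 1 = t}).toReal)
      atTop (𝓝 0) := by
  have hbound : Tendsto (fun n : ℕ => (m n : ℝ) / n *
      (2 * (⌊M⌋₊.choose 2 : ℝ) * ((n : ℝ) - 1)⁻¹ + (⌊M⌋₊ : ℝ) ^ 2 * (n : ℝ)⁻¹)) atTop (𝓝 0) := by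
    have hn : Tendsto (fun n : ℕ => (n : ℝ)) atTop atTop := tendsto_natCast_atTop_atTop
    have h1 : Tendsto (fun n : ℕ => ((n : ℝ) - 1)⁻¹) atTop (𝓝 0) :=
      tendsto_inv_atTop_zero.comp (tendsto_atTop_add_const_right _ (-1) hn)
    have h2 : Tendsto (fun n : ℕ => (n : ℝ)⁻¹) atTop (𝓝 0) := tendsto_inv_atTop_zero.comp hn
    simpa using hratio.mul ((h1.const_mul (2 * (⌊M⌋₊.choose 2 : ℝ))).add
      (h2.const_mul ((⌊M⌋₊ : ℝ) ^ 2)))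
  refine squeeze_zero_norm' ?_ hbound
  filter_upwards [eventually_ge_atTop 2] with n hn
  refine (abs_degTr_covariance_le hn (m n) (Pn n) M s t).trans_eq ?_
  have hn' : (2 : ℝ) ≤ n := by exact_mod_cast hn
  have h0 : (n : ℝ) ≠ 0 := by linarith
  have h1 : (n : ℝ) - 1 ≠ 0 := by linarith
  rw [Nat.cast_choose_two ℝ n]
  field_simp
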